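/- Let C2 ⊆ F_2^{32} be any self-dual linear binary code of length 32 whose minimum Hamming weight is 8 (for instance the Reed–Muller code RM(2,5), a [32,16,8] self-dual code), and let Γ ⊆ ℤ^{32} be the Construction C* constellation built from the 3-level code C determined by C2. Then Γ is an additive subgroup of ℤ^{32} of index 2^48, and the minimum squared Euclidean norm of a nonzero element of Γ is 32. Consequently the Hermite invariant d_min^2 / vol^{2/32} of this lattice equals 4, the Hermite constant of the Barnes–Wall lattice BW_32. -/

import Mathlib

open Finset

/-- The natural embedding `ψ : F_2^n → ℤ^n`, sending the bits 0,1 to the integers 0,1. -/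
def psi {n : ℕ} (x : Fin n → ZMod 2) : Fin n → ℤ := fun i => ((x i).val : ℤ)

/-- The Hamming weight of a binary vector. -/
def wt {n : ℕ} (x : Fin n → ZMod 2) : ℕ := (Finset.univ.filter fun i => x i ≠ 0).card

/-- Membership in the 3-level code `C ⊆ F_2^{3n}` determined by `C2`:
`(c1,c2,c3) ∈ C` iff `c2 ∈ C2` and either `c1 = (0,…,0)` with `c3` of even Hamming
weight, or `c1 = (1,…,1)` with `c3` of odd Hamming weight. -/
def inCode {n : ℕ} (C2 : Set (Fin n → ZMod 2)) (c1 c2 c3 : Fin n → ZMod 2) : Prop :=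
  c2 ∈ C2 ∧ ((c1 = 0 ∧ Even (wt c3)) ∨ (c1 = 1 ∧ ¬ Even (wt c3)))

/-- The Construction C* constellation `Γ = {c1 + 2 c2 + 4 c3 + 8 z : (c1,c2,c3) ∈ C, z ∈ ℤ^n}`. -/
def Gamma {n : ℕ} (C2 : Set (Fin n → ZMod 2)) : Set (Fin n → ℤ) :=
  { v | ∃ c1 c2 c3 : Fin n → ZMod 2, ∃ z : Fin n → ℤ,
      inCode C2 c1 c2 c3 ∧ v = psi c1 + 2 • psi c2 + 4 • psi c3 + 8 • z }

/-- Coordinatewise embedding of `ℤ^n` into `ℝ^n`. -/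
def toReal {n : ℕ} (v : Fin n → ℤ) : Fin n → ℝ := fun i => (v i : ℝ)

/-- A binary code is self-orthogonal if `⟨c, c'⟩ = 0` for all codewords `c, c'`. -/
def SelfOrthogonal {n : ℕ} (C : Set (Fin n → ZMod 2)) : Prop :=
  ∀ c ∈ C, ∀ c' ∈ C, ∑ i, c i * c' i = 0

/-- The dual of a binary code `C ⊆ F_2^n`. -/
def dualCode {n : ℕ} (C : Set (Fin n → ZMod 2)) : Set (Fin n → ZMod 2) :=
  { x | ∀ c ∈ C, ∑ i, x i * c i = 0 }

theorem zmod_two_intCast_eq_ite (m : ℤ) : (m : ZMod 2) = if m % 2 = 0 then 0 else 1 := by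
  rw [← ZMod.intCast_mod m 2]
  rcases Int.emod_two_eq_zero_or_one m with h | h <;> simp [h]

theorem zmod_two_cast_add_ediv_two (x y : ℤ) :
    (((x + y) / 2 : ℤ) : ZMod 2) =
      ((x / 2 : ℤ) : ZMod 2) + ((y / 2 : ℤ) : ZMod 2) + (x : ZMod 2) * (y : ZMod 2) := by
  simp only [zmod_two_intCast_eq_ite]
  split_ifs <;> first | (exfalso; omega) | decide

theorem zmod_two_cast_add_ediv_four (x y : ℤ) :
    (((x + y) / 4 : ℤ) : ZMod 2) =
      ((x / 4 : ℤ) : ZMod 2) + ((y / 4 : ℤ) : ZMod 2)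
        + ((x / 2 : ℤ) : ZMod 2) * ((y / 2 : ℤ) : ZMod 2)
        + (x : ZMod 2) * (y : ZMod 2) * (((x / 2 : ℤ) : ZMod 2) + ((y / 2 : ℤ) : ZMod 2)) := by
  have hdiv : (x + y) / 2 = x / 2 + y / 2 + x % 2 * (y % 2) ∧ x % 2 * (y % 2) / 2 = 0 := by
    rcases Int.emod_two_eq_zero_or_one x with hx | hx <;>
      rcases Int.emod_two_eq_zero_or_one y with hy | hy <;> rw [hx, hy] <;> omega
  have hfour : ∀ m : ℤ, m / 4 = m / 2 / 2 := fun m => by omega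
  have hmod : ∀ m : ℤ, ((m % 2 : ℤ) : ZMod 2) = m := fun m => ZMod.intCast_mod m 2
  rw [hfour (x + y), hdiv.1, zmod_two_cast_add_ediv_two, zmod_two_cast_add_ediv_two, hdiv.2,
    ← hfour x, ← hfour y]
  push_cast
  rw [hmod, hmod]
  ring

theorem zmod_two_cast_neg_ediv_two (x : ℤ) :
    (((-x) / 2 : ℤ) : ZMod 2) = ((x / 2 : ℤ) : ZMod 2) + (x : ZMod 2) := by
  simp only [zmod_two_intCast_eq_ite]
  split_ifs <;> first | (exfalso; omega) | decide

theorem zmod_two_cast_neg_ediv_four (x : ℤ) :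
    (((-x) / 4 : ℤ) : ZMod 2) = ((x / 4 : ℤ) : ZMod 2) + (x : ZMod 2)
      + ((x / 2 : ℤ) : ZMod 2) + (x : ZMod 2) * ((x / 2 : ℤ) : ZMod 2) := by
  simp only [zmod_two_intCast_eq_ite]
  split_ifs <;> first | (exfalso; omega) | decide

theorem wt_cast {n : ℕ} (c : Fin n → ZMod 2) : (wt c : ZMod 2) = ∑ i, c i := by
  have h : ∀ a : ZMod 2, (if a ≠ 0 then (1 : ZMod 2) else 0) = a := by decide
  simp only [wt, card_filter, Nat.cast_sum, Nat.cast_ite, Nat.cast_one, Nat.cast_zero, h]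

theorem even_wt_iff {n : ℕ} (c : Fin n → ZMod 2) : Even (wt c) ↔ ∑ i, c i = 0 := by
  rw [← wt_cast, ZMod.natCast_eq_zero_iff_even]

section SelfDual

variable {n : ℕ} {C : Submodule (ZMod 2) (Fin n → ZMod 2)}

theorem sum_mul_eq_zero_of_selfDual (h : (C : Set (Fin n → ZMod 2)) = dualCode C)
    {c d : Fin n → ZMod 2} (hc : c ∈ C) (hd : d ∈ C) : ∑ i, c i * d i = 0 := by
  have : c ∈ dualCode (C : Set (Fin n → ZMod 2)) := h ▸ hc
  exact this d hd

theorem sum_eq_zero_of_selfDual (h : (C : Set (Fin n → ZMod 2)) = dualCode C)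
    {c : Fin n → ZMod 2} (hc : c ∈ C) : ∑ i, c i = 0 := by
  have hsq : ∀ a : ZMod 2, a * a = a := by decide
  simpa only [hsq] using sum_mul_eq_zero_of_selfDual h hc hc

theorem one_mem_of_selfDual (h : (C : Set (Fin n → ZMod 2)) = dualCode C) :
    (1 : Fin n → ZMod 2) ∈ C := by
  have : (1 : Fin n → ZMod 2) ∈ dualCode (C : Set (Fin n → ZMod 2)) := fun c hc => by
    simpa using sum_eq_zero_of_selfDual h hc
  rw [← h] at this
  exact this

theorem const_mem_of_selfDual (h : (C : Set (Fin n → ZMod 2)) = dualCode C) (e : ZMod 2) :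
    (fun _ => e : Fin n → ZMod 2) ∈ C := by
  convert C.smul_mem e (one_mem_of_selfDual h) using 1
  ext; simp

theorem finrank_add_self_of_selfDual (h : (C : Set (Fin n → ZMod 2)) = dualCode C) :
    Module.finrank (ZMod 2) C + Module.finrank (ZMod 2) C = n := by
  set B : LinearMap.BilinForm (ZMod 2) (Fin n → ZMod 2) := Matrix.toBilin' 1 with hB
  have hnd : B.Nondegenerate :=
    Matrix.Nondegenerate.toBilin' (Matrix.nondegenerate_of_det_ne_zero (by simp))
  have hBapp : ∀ x y, B x y = ∑ i, x i * y i := fun x y => by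
    simp [hB, Matrix.toBilin'_apply', dotProduct]
  have horth : B.orthogonal C = C := by
    apply SetLike.coe_injective
    conv_rhs => rw [h]
    ext x
    simp [LinearMap.BilinForm.mem_orthogonal_iff, dualCode,
      hBapp, mul_comm]
  have hfr := LinearMap.BilinForm.finrank_orthogonal hnd C
  have hle := Submodule.finrank_le C
  rw [horth, Module.finrank_fin_fun] at hfr
  rw [Module.finrank_fin_fun] at hle
  omega

theorem index_of_selfDual (h : (C : Set (Fin n → ZMod 2)) = dualCode C) :
    C.toAddSubgroup.index = 2 ^ (n / 2) := by
  have hfr := finrank_add_self_of_selfDual h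
  have hcard : Nat.card C.toAddSubgroup = 2 ^ (n / 2) := by
    change Nat.card C = _
    rw [Module.natCard_eq_pow_finrank (K := ZMod 2), Nat.card_zmod]
    congr 1; omega
  have hmul := C.toAddSubgroup.card_mul_index
  have hpow : 2 ^ n = 2 ^ (n / 2) * 2 ^ (n / 2) := by
    rw [← pow_add]; congr 1; omega
  rw [hcard, Nat.card_fun, Nat.card_zmod, Nat.card_fin, hpow] at hmul
  exact Nat.eq_of_mul_eq_mul_left (by positivity) hmul

/-- The points of the Construction C* constellation of a self-dual code, described through the
first three binary digits of their coordinates. -/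
def starSubgroup (h : (C : Set (Fin n → ZMod 2)) = dualCode C) : AddSubgroup (Fin n → ℤ) where
  carrier := {v | ∃ e : ZMod 2, (∀ i, (v i : ZMod 2) = e) ∧
    (fun i => ((v i / 2 : ℤ) : ZMod 2)) ∈ C ∧ ∑ i, ((v i / 4 : ℤ) : ZMod 2) = e}
  zero_mem' := ⟨0, by simp, by simp; exact C.zero_mem, by simp⟩
  add_mem' := by
    rintro v w ⟨e, hv1, hv2, hv3⟩ ⟨f, hw1, hw2, hw3⟩
    refine ⟨e + f, fun i => by simp [hv1, hw1], ?_, ?_⟩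
    · simp only [Pi.add_apply, zmod_two_cast_add_ediv_two, hv1, hw1]
      exact C.add_mem (C.add_mem hv2 hw2) (const_mem_of_selfDual h _)
    · simp only [Pi.add_apply, zmod_two_cast_add_ediv_four, hv1, hw1, sum_add_distrib, hv3, hw3,
        ← mul_sum, sum_mul_eq_zero_of_selfDual h hv2 hw2, sum_eq_zero_of_selfDual h hv2,
        sum_eq_zero_of_selfDual h hw2]
      ring
  neg_mem' := by
    rintro v ⟨e, hv1, hv2, hv3⟩
    refine ⟨e, fun i => by simp [hv1, ZMod.neg_eq_self_mod_two], ?_, ?_⟩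
    · simp only [Pi.neg_apply, zmod_two_cast_neg_ediv_two, hv1]
      exact C.add_mem hv2 (const_mem_of_selfDual h _)
    · simp only [Pi.neg_apply, zmod_two_cast_neg_ediv_four, hv1, sum_add_distrib, hv3,
        ← mul_sum, sum_eq_zero_of_selfDual h hv2,
        sum_eq_zero_of_selfDual h (const_mem_of_selfDual h e)]
      ring

theorem mem_starSubgroup (h : (C : Set (Fin n → ZMod 2)) = dualCode C) {v : Fin n → ℤ} :
    v ∈ starSubgroup h ↔ ∃ e : ZMod 2, (∀ i, (v i : ZMod 2) = e) ∧
      (fun i => ((v i / 2 : ℤ) : ZMod 2)) ∈ C ∧ ∑ i, ((v i / 4 : ℤ) : ZMod 2) = e :=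
  Iff.rfl

theorem zmod_two_intCast_digits (a b c : ZMod 2) (z : ℤ) :
    (((a.val : ℤ) + 2 * b.val + 4 * c.val + 8 * z : ℤ) : ZMod 2) = a ∧
    ((((a.val : ℤ) + 2 * b.val + 4 * c.val + 8 * z) / 2 : ℤ) : ZMod 2) = b ∧
    ((((a.val : ℤ) + 2 * b.val + 4 * c.val + 8 * z) / 4 : ℤ) : ZMod 2) = c := by
  have hval : ∀ d : ZMod 2, (d = 0 ∧ d.val = 0) ∨ (d = 1 ∧ d.val = 1) := by decide
  simp only [zmod_two_intCast_eq_ite]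
  rcases hval a with ⟨ha, ha'⟩ | ⟨ha, ha'⟩ <;> rcases hval b with ⟨hb, hb'⟩ | ⟨hb, hb'⟩ <;>
    rcases hval c with ⟨hc, hc'⟩ | ⟨hc, hc'⟩ <;> rw [ha', hb', hc', ha, hb, hc] <;>
    refine ⟨?_, ?_, ?_⟩ <;> split_ifs <;> first | rfl | (exfalso; omega)

theorem psi_digits_apply (c1 c2 c3 : Fin n → ZMod 2) (z : Fin n → ℤ) (i : Fin n) :
    (psi c1 + 2 • psi c2 + 4 • psi c3 + 8 • z) i =
      (c1 i).val + 2 * (c2 i).val + 4 * (c3 i).val + 8 * z i := by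
  simp [psi]

theorem zmod_two_ne_zero_iff (a : ZMod 2) : a ≠ 0 ↔ a = 1 := by
  revert a; decide

theorem Gamma_eq_starSubgroup (h : (C : Set (Fin n → ZMod 2)) = dualCode C) :
    Gamma (C : Set (Fin n → ZMod 2)) = starSubgroup h := by
  ext v
  rw [SetLike.mem_coe, mem_starSubgroup]
  constructor
  · rintro ⟨c1, c2, c3, z, ⟨hc2, hc⟩, rfl⟩
    simp only [psi_digits_apply, zmod_two_intCast_digits]
    rcases hc with ⟨rfl, hw⟩ | ⟨rfl, hw⟩
    · exact ⟨0, fun _ => rfl, hc2, (even_wt_iff c3).1 hw⟩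
    · exact ⟨1, fun _ => rfl, hc2, (zmod_two_ne_zero_iff _).1 (mt (even_wt_iff c3).2 hw)⟩
  · rintro ⟨e, h1, h2, h3⟩
    refine ⟨fun i => (v i : ZMod 2), _, fun i => ((v i / 4 : ℤ) : ZMod 2), fun i => v i / 8,
      ⟨h2, ?_⟩, ?_⟩
    · rw [even_wt_iff, ← Ne, zmod_two_ne_zero_iff, h3]
      have he : ∀ a : ZMod 2, a = 0 ∨ a = 1 := by decide
      rcases he e with rfl | rfl
      · exact Or.inl ⟨funext h1, rfl⟩
      · exact Or.inr ⟨funext h1, rfl⟩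
    · ext i
      rw [psi_digits_apply]
      simp only [ZMod.val_intCast]
      omega

/-- Doubling on `ℤ^n`. -/
def doubleHom (n : ℕ) : (Fin n → ℤ) →+ (Fin n → ℤ) where
  toFun v := fun i => 2 * v i
  map_zero' := by ext; simp
  map_add' v w := by ext; simp [mul_add]

/-- Coordinatewise reduction modulo two. -/
def modTwoHom (n : ℕ) : (Fin n → ℤ) →+ (Fin n → ZMod 2) where
  toFun v := fun i => (v i : ZMod 2)
  map_zero' := by ext; simp
  map_add' v w := by ext; simp

theorem modTwoHom_surjective (n : ℕ) : Function.Surjective (modTwoHom n) := fun x =>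
  ⟨fun i => ((x i).val : ℤ), by ext; simp [modTwoHom]⟩

theorem mem_range_doubleHom {v : Fin n → ℤ} :
    v ∈ (doubleHom n).range ↔ ∀ i, (v i : ZMod 2) = 0 := by
  simp only [ZMod.intCast_zmod_eq_zero_iff_dvd]
  constructor
  · rintro ⟨w, rfl⟩ i
    exact ⟨w i, rfl⟩
  · intro hv
    choose w hw using hv
    exact ⟨w, funext fun i => (hw i).symm⟩

theorem index_range_doubleHom (n : ℕ) : (doubleHom n).range.index = 2 ^ n := by
  have hker : (doubleHom n).range = (modTwoHom n).ker := by
    ext v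
    rw [mem_range_doubleHom, AddMonoidHom.mem_ker]
    exact funext_iff.symm
  rw [hker, AddSubgroup.index_ker, AddMonoidHom.range_eq_top.2 (modTwoHom_surjective n)]
  simp

theorem mem_comap_doubleHom (h : (C : Set (Fin n → ZMod 2)) = dualCode C) {w : Fin n → ℤ} :
    w ∈ (starSubgroup h).comap (doubleHom n) ↔
      modTwoHom n w ∈ C ∧ ∑ i, ((w i / 2 : ℤ) : ZMod 2) = 0 := by
  have h2 : ∀ m : ℤ, ((2 * m : ℤ) : ZMod 2) = 0 := fun m => by
    rw [ZMod.intCast_eq_zero_iff_even]; exact even_two_mul m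
  have hd2 : ∀ m : ℤ, 2 * m / 2 = m := fun m => by omega
  have hd4 : ∀ m : ℤ, 2 * m / 4 = m / 2 := fun m => by omega
  rw [AddSubgroup.mem_comap, mem_starSubgroup]
  simp only [doubleHom, AddMonoidHom.coe_mk, ZeroHom.coe_mk, h2, hd2, hd4]
  exact ⟨fun ⟨_, h0, hC, hs⟩ => ⟨hC, by
      rcases isEmpty_or_nonempty (Fin n) with _ | ⟨⟨i⟩⟩
      · simp
      · rw [hs, ← h0 i]⟩,
    fun ⟨hC, hs⟩ => ⟨0, fun _ => rfl, hC, hs⟩⟩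

theorem index_comap_doubleHom [NeZero n] (h : (C : Set (Fin n → ZMod 2)) = dualCode C) :
    ((starSubgroup h).comap (doubleHom n)).index = 2 * 2 ^ (n / 2) := by
  have hle : (starSubgroup h).comap (doubleHom n) ≤ C.toAddSubgroup.comap (modTwoHom n) :=
    fun w hw => ((mem_comap_doubleHom h).1 hw).1
  rw [← AddSubgroup.relIndex_mul_index hle,
    AddSubgroup.index_comap_of_surjective _ (modTwoHom_surjective n), index_of_selfDual h]
  congr 1
  rw [AddSubgroup.relIndex_eq_two_iff_exists_notMem_and']
  have hmod : modTwoHom n (Pi.single 0 2) = 0 := by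
    ext i
    rcases eq_or_ne i 0 with rfl | hi
    · simp [modTwoHom]; rfl
    · simp [modTwoHom, hi]
  have hmem : Pi.single 0 2 ∈ C.toAddSubgroup.comap (modTwoHom n) := by
    rw [AddSubgroup.mem_comap, hmod]
    exact C.zero_mem
  have hdiv : ∀ i : Fin n, (((Pi.single 0 2 : Fin n → ℤ) i / 2 : ℤ) : ZMod 2) =
      (Pi.single 0 1 : Fin n → ZMod 2) i := fun i => by
    rcases eq_or_ne i 0 with rfl | hi
    · simp
    · simp [hi]
  refine ⟨Pi.single 0 2, hmem, ?_, fun b hb => ?_⟩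
  · rw [mem_comap_doubleHom, not_and]
    intro _
    simp [hdiv]
  · by_cases hs : ∑ i, ((b i / 2 : ℤ) : ZMod 2) = 0
    · exact Or.inr ((mem_comap_doubleHom h).2 ⟨hb, hs⟩)
    · refine Or.inl ((mem_comap_doubleHom h).2 ⟨AddSubgroup.add_mem _ hmem hb, ?_⟩)
      have hzero : ∀ i : Fin n, (((Pi.single 0 2 : Fin n → ℤ) i : ℤ) : ZMod 2) = 0 :=
        fun i => congrFun hmod i
      simp only [Pi.add_apply, zmod_two_cast_add_ediv_two, hzero, hdiv, sum_add_distrib,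
        (zmod_two_ne_zero_iff _).1 hs]
      simp
      rfl

theorem relIndex_range_doubleHom_starSubgroup [NeZero n]
    (h : (C : Set (Fin n → ZMod 2)) = dualCode C) :
    (doubleHom n).range.relIndex (starSubgroup h) = 2 := by
  rw [AddSubgroup.relIndex_eq_two_iff_exists_notMem_and']
  have hpar : ∀ i : Fin n,
      ((1 + Pi.single (M := fun _ => ℤ) 0 4 i : ℤ) : ZMod 2) = 1 := fun i => by
    rcases eq_or_ne i 0 with rfl | hi
    · simp; rfl
    · simp [hi]
  have htwo : ∀ i : Fin n,
      (((1 + Pi.single (M := fun _ => ℤ) 0 4 i) / 2 : ℤ) : ZMod 2) = 0 := fun i => by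
    rcases eq_or_ne i 0 with rfl | hi
    · simp; rfl
    · simp [hi]
  have hfour : ∀ i : Fin n, (((1 + Pi.single (M := fun _ => ℤ) 0 4 i) / 4 : ℤ) : ZMod 2) =
      Pi.single (M := fun _ => ZMod 2) 0 1 i := fun i => by
    rcases eq_or_ne i 0 with rfl | hi
    · simp
    · simp [hi]
  refine ⟨fun i => 1 + Pi.single (M := fun _ => ℤ) 0 4 i, ⟨1, hpar, ?_, ?_⟩, ?_, ?_⟩
  · simp only [htwo]
    exact C.zero_mem
  · simp [hfour]
  · rw [mem_range_doubleHom]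
    intro hz
    have := hz 0
    rw [hpar] at this
    exact one_ne_zero this
  · rintro b ⟨e, he, -, -⟩
    rw [mem_range_doubleHom, mem_range_doubleHom]
    by_cases h0 : e = 0
    · exact Or.inr fun i => (he i).trans h0
    · left
      intro i
      rw [Pi.add_apply, Int.cast_add, he, hpar, (zmod_two_ne_zero_iff e).1 h0]
      rfl

theorem index_starSubgroup [NeZero n] (h : (C : Set (Fin n → ZMod 2)) = dualCode C) :
    (starSubgroup h).index = 2 ^ (n / 2) * 2 ^ n := by
  have h1 := AddSubgroup.relIndex_inf_mul_relIndex (starSubgroup h) (doubleHom n).range ⊤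
  have h2 := AddSubgroup.relIndex_inf_mul_relIndex (doubleHom n).range (starSubgroup h) ⊤
  simp only [inf_top_eq, AddSubgroup.relIndex_top_right] at h1 h2
  rw [← AddSubgroup.index_comap, index_comap_doubleHom, index_range_doubleHom] at h1
  rw [relIndex_range_doubleHom_starSubgroup, inf_comm, ← h1, mul_assoc] at h2
  exact Nat.eq_of_mul_eq_mul_left two_pos h2

theorem thirtyTwo_le_sum_sq (h : (C : Set (Fin n → ZMod 2)) = dualCode C) (hn : 32 ≤ n)
    (hwt : ∀ c ∈ C, c ≠ 0 → 8 ≤ wt c) {v : Fin n → ℤ} (hv : v ∈ starSubgroup h) (hv0 : v ≠ 0) :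
    32 ≤ ∑ i, v i ^ 2 := by
  obtain ⟨e, he, hc, hs⟩ := hv
  by_cases h0 : e = 0
  · subst h0
    have heven : ∀ i, 2 ∣ v i := fun i => (ZMod.intCast_zmod_eq_zero_iff_dvd _ 2).1 (he i)
    by_cases hc0 : (fun i => ((v i / 2 : ℤ) : ZMod 2)) = 0
    · have hdvd : ∀ i, v i = 4 * (v i / 4) := fun i => by
        have h2 : (2 : ℤ) ∣ v i / 2 :=
          (ZMod.intCast_zmod_eq_zero_iff_dvd _ 2).1 (congrFun hc0 i)
        have := heven i
        omega
      have hsum : ∑ i, v i ^ 2 = 16 * ∑ i, (v i / 4) ^ 2 := by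
        rw [mul_sum]
        refine sum_congr rfl fun i _ => ?_
        conv_lhs => rw [hdvd i]
        ring
      have hsq : ∀ a : ZMod 2, a ^ 2 = a := by decide
      have hpar : (2 : ℤ) ∣ ∑ i, (v i / 4) ^ 2 := by
        refine (ZMod.intCast_zmod_eq_zero_iff_dvd _ 2).1 ?_
        push_cast
        simpa only [hsq] using hs
      obtain ⟨j, hj⟩ := Function.ne_iff.1 hv0
      have hpos : 0 < ∑ i, (v i / 4) ^ 2 := by
        refine sum_pos' (fun i _ => sq_nonneg _) ⟨j, mem_univ j, ?_⟩
        have hj4 : v j / 4 ≠ 0 := fun h4 => hj (by rw [hdvd j, h4]; rfl)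
        positivity
      omega
    · have hw := hwt _ hc hc0
      have hle : (4 * wt (fun i => ((v i / 2 : ℤ) : ZMod 2)) : ℤ) ≤ ∑ i, v i ^ 2 := by
        simp only [wt, card_filter, Nat.cast_sum, mul_sum]
        refine sum_le_sum fun i _ => ?_
        split_ifs with hi
        · have hvi : v i ≠ 0 := fun hz => hi (by simp [hz])
          obtain ⟨m, hm⟩ := heven i
          have hm0 : m ≠ 0 := fun hz => hvi (by simp [hm, hz])
          have : 0 < m ^ 2 := by positivity
          rw [hm, mul_pow]
          push_cast
          linarith
        · simpa using sq_nonneg (v i)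
      omega
  · have hone : ∀ i, 1 ≤ v i ^ 2 := fun i => by
      have hvi : v i ≠ 0 := fun hz => h0 (by rw [← he i, hz]; rfl)
      have : 0 < v i ^ 2 := by positivity
      exact this
    calc (32 : ℤ) ≤ n := by exact_mod_cast hn
      _ = ∑ _i : Fin n, (1 : ℤ) := by simp
      _ ≤ ∑ i, v i ^ 2 := sum_le_sum fun i _ => hone i

end SelfDual

/-- with `C2` any self-dual linear binary code of length 32 and minimum
Hamming weight 8, e.g. the Reed–Muller code RM(2,5), `Γ` is an additive subgroup of `ℤ^32` of index `2^48`, its minimum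
squared norm of a nonzero point is `32`, and its Hermite invariant
`d_min^2 / vol^{2/32}` equals `4`. -/
theorem constructionCstar_dim32
    (C2 : Submodule (ZMod 2) (Fin 32 → ZMod 2))
    (hsd : (C2 : Set (Fin 32 → ZMod 2)) = dualCode (C2 : Set (Fin 32 → ZMod 2)))
    (hmin : IsLeast {w : ℕ | ∃ c ∈ C2, c ≠ 0 ∧ w = wt c} 8) :
    ∃ H : AddSubgroup (Fin 32 → ℤ),
      Gamma (C2 : Set (Fin 32 → ZMod 2)) = ↑H ∧
      H.index = 2 ^ 48 ∧
      IsLeast {m : ℤ | ∃ v ∈ Gamma (C2 : Set (Fin 32 → ZMod 2)),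
        v ≠ 0 ∧ m = ∑ i, (v i) ^ 2} 32 ∧
      (32 : ℝ) / ((H.index : ℝ) ^ ((2 : ℝ) / 32)) = 4 := by
  have hindex : (starSubgroup hsd).index = 2 ^ 48 := by
    rw [index_starSubgroup]; norm_num
  refine ⟨starSubgroup hsd, Gamma_eq_starSubgroup hsd, hindex, ⟨?_, ?_⟩, ?_⟩
  · refine ⟨fun i => if i < 2 then 4 else 0, ?_, fun h0 => ?_, by decide⟩
    · rw [Gamma_eq_starSubgroup hsd]
      refine ⟨0, by decide, ?_, by decide⟩
      convert C2.zero_mem using 1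
      decide
    · simpa using congrFun h0 0
  · rintro m ⟨v, hv, hv0, rfl⟩
    rw [Gamma_eq_starSubgroup hsd] at hv
    exact thirtyTwo_le_sum_sq hsd le_rfl (fun c hc hc0 => hmin.2 ⟨c, hc, hc0, rfl⟩) hv hv0
  · rw [hindex]
    have hpow : (((2 ^ 48 : ℕ) : ℝ) ^ ((2 : ℝ) / 32)) = 8 := by
      rw [Nat.cast_pow, Nat.cast_ofNat, ← Real.rpow_natCast, ← Real.rpow_mul (by norm_num),
        show ((48 : ℕ) : ℝ) * (2 / 32) = (3 : ℕ) by norm_num, Real.rpow_natCast]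
      norm_num
    rw [hpow]
    norm_num
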